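/- arXiv:math/0609160 — 9 statements merged into one kernel-verified Lean document; each statement's English description precedes it below -/
import Mathlib

section
/- Let X be an ℍ-vector space. Then: (i) Re(x) ∈ X_Re for every x ∈ X; (ii) Re(x) = x for every x ∈ X_Re (hence Re ∘ Re = Re and the image of Re is exactly X_Re); and (iii) every x ∈ X satisfies the polarization identity x = Σ_{e ∈ B} Re((star e) • x) • e. -/
open MulOpposite

local notation "ℍ" => Quaternion ℝ

/-- The standard basis `1, i, j, k` of the quaternions. -/
noncomputable def qB : Fin 4 → ℍ := ![1, ⟨0,1,0,0⟩, ⟨0,0,1,0⟩, ⟨0,0,0,1⟩]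

/-- The real part of an `ℍ`-bimodule. -/
def reSet (X : Type*) [SMul ℍ X] [SMul ℍᵐᵒᵖ X] : Set X :=
  {x | ∀ α : ℍ, α • x = op α • x}

/-- The projection `Re` onto the real part. -/
noncomputable def reMap (X : Type*) [AddCommGroup X] [Module ℝ X] [SMul ℍ X] [SMul ℍᵐᵒᵖ X] (x : X) : X :=
  (4 : ℝ)⁻¹ • ∑ e : Fin 4, star (qB e) • (op (qB e) • x)

@[simp] theorem qB_one_coords :
    (qB 1).re = 0 ∧ (qB 1).imI = 1 ∧ (qB 1).imJ = 0 ∧ (qB 1).imK = 0 :=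
  ⟨rfl, rfl, rfl, rfl⟩

@[simp] theorem qB_two_coords :
    (qB 2).re = 0 ∧ (qB 2).imI = 0 ∧ (qB 2).imJ = 1 ∧ (qB 2).imK = 0 :=
  ⟨rfl, rfl, rfl, rfl⟩

@[simp] theorem qB_three_coords :
    (qB 3).re = 0 ∧ (qB 3).imI = 0 ∧ (qB 3).imJ = 0 ∧ (qB 3).imK = 1 :=
  ⟨rfl, rfl, rfl, rfl⟩

theorem star_qB : star (qB 1) = -qB 1 ∧ star (qB 2) = -qB 2 ∧ star (qB 3) = -qB 3 := by
  refine ⟨?_, ?_, ?_⟩ <;> ext <;> simp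

theorem reMap_eq {X : Type*} [AddCommGroup X] [Module ℝ X] [Module ℍ X] [Module ℍᵐᵒᵖ X] (x : X) :
    reMap X x = (4 : ℝ)⁻¹ • (x - qB 1 • (op (qB 1) • x) - qB 2 • (op (qB 2) • x)
      - qB 3 • (op (qB 3) • x)) := by
  have h0 : qB 0 = 1 := rfl
  obtain ⟨h1, h2, h3⟩ := star_qB
  simp only [reMap, Fin.sum_univ_four, h0, h1, h2, h3, star_one, op_one, one_smul, neg_smul]
  congr 1
  abel

theorem quaternion_eq_sum_qB (α : ℍ) :
    α = α.re • (1 : ℍ) + α.imI • qB 1 + α.imJ • qB 2 + α.imK • qB 3 := by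
  ext <;> simp [Quaternion.re_one, Quaternion.imI_one, Quaternion.imJ_one, Quaternion.imK_one]

theorem qB_mul_table :
    (qB 1 * qB 1 = -1 ∧ qB 2 * qB 2 = -1 ∧ qB 3 * qB 3 = -1) ∧
    (qB 1 * qB 2 = qB 3 ∧ qB 2 * qB 3 = qB 1 ∧ qB 3 * qB 1 = qB 2) ∧
    (qB 2 * qB 1 = -qB 3 ∧ qB 3 * qB 2 = -qB 1 ∧ qB 1 * qB 3 = -qB 2) := by
  refine ⟨⟨?_, ?_, ?_⟩, ⟨?_, ?_, ?_⟩, ?_, ?_, ?_⟩ <;> ext <;>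
    simp [Quaternion.re_one, Quaternion.imI_one, Quaternion.imJ_one, Quaternion.imK_one]

theorem mem_reSet_of_qB {X : Type*} [AddCommGroup X] [Module ℝ X] [Module ℍ X] [Module ℍᵐᵒᵖ X]
    [IsScalarTower ℝ ℍ X] [IsScalarTower ℝ ℍᵐᵒᵖ X] {x : X}
    (h1 : qB 1 • x = op (qB 1) • x) (h2 : qB 2 • x = op (qB 2) • x)
    (h3 : qB 3 • x = op (qB 3) • x) : x ∈ reSet X := by
  intro α
  rw [quaternion_eq_sum_qB α]
  simp only [op_add, op_smul, op_one, add_smul, smul_assoc, one_smul, h1, h2, h3]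

theorem quaternion_smul_real_smul {X : Type*} [AddCommGroup X] [Module ℝ X] [Module ℍ X]
    [IsScalarTower ℝ ℍ X] (α : ℍ) (r : ℝ) (x : X) : α • r • x = r • α • x := by
  rw [← smul_one_smul ℍ r x, ← smul_one_smul ℍ r (α • x), smul_smul, smul_smul]
  simp

theorem op_quaternion_smul_real_smul {X : Type*} [AddCommGroup X] [Module ℝ X]
    [Module ℍᵐᵒᵖ X] [IsScalarTower ℝ ℍᵐᵒᵖ X] (α : ℍ) (r : ℝ) (x : X) :
    op α • r • x = r • op α • x := by
  rw [← smul_one_smul ℍᵐᵒᵖ r x, ← smul_one_smul ℍᵐᵒᵖ r (op α • x), smul_smul, smul_smul]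
  simp

theorem reMap_mem_reSet {X : Type*} [AddCommGroup X] [Module ℝ X] [Module ℍ X] [Module ℍᵐᵒᵖ X]
    [IsScalarTower ℝ ℍ X] [IsScalarTower ℝ ℍᵐᵒᵖ X] [SMulCommClass ℍ ℍᵐᵒᵖ X] (x : X) :
    reMap X x ∈ reSet X := by
  obtain ⟨⟨h11, h22, h33⟩, ⟨h12, h23, h31⟩, h21, h32, h13⟩ := qB_mul_table
  have hc (a b : ℍ) (y : X) : op a • b • y = b • op a • y := (smul_comm b (op a) y).symm
  apply mem_reSet_of_qB <;> rw [reMap_eq] <;>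
    simp only [quaternion_smul_real_smul, op_quaternion_smul_real_smul, smul_sub, hc] <;>
    simp only [smul_smul, ← op_mul, h11, h22, h33, h12, h23, h31, h21, h32, h13] <;>
    simp only [op_neg, op_one, neg_smul, one_smul, smul_neg] <;>
    abel

theorem reMap_eq_self {X : Type*} [AddCommGroup X] [Module ℝ X] [Module ℍ X] [Module ℍᵐᵒᵖ X]
    {x : X} (hx : x ∈ reSet X) : reMap X x = x := by
  obtain ⟨⟨h11, h22, h33⟩, -⟩ := qB_mul_table
  rw [reMap_eq, ← hx, ← hx, ← hx]
  simp only [smul_smul, h11, h22, h33, neg_smul, one_smul]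
  module

theorem sum_op_qB_smul_reMap {X : Type*} [AddCommGroup X] [Module ℝ X] [Module ℍ X] [Module ℍᵐᵒᵖ X]
    [IsScalarTower ℝ ℍ X] [IsScalarTower ℝ ℍᵐᵒᵖ X] [SMulCommClass ℍ ℍᵐᵒᵖ X] (x : X) :
    ∑ e : Fin 4, op (qB e) • reMap X (star (qB e) • x) = x := by
  obtain ⟨⟨h11, h22, h33⟩, ⟨h12, h23, h31⟩, h21, h32, h13⟩ := qB_mul_table
  have hc (a b : ℍ) (y : X) : op a • b • y = b • op a • y := (smul_comm b (op a) y).symm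
  have h0 : qB 0 = 1 := rfl
  obtain ⟨h1, h2, h3⟩ := star_qB
  simp only [Fin.sum_univ_four, reMap_eq, h0, h1, h2, h3, star_one, op_one, one_smul, neg_smul,
    op_quaternion_smul_real_smul, smul_sub, smul_neg, hc]
  simp only [smul_smul, ← op_mul, h11, h22, h33, h12, h23, h31, h21, h32, h13]
  simp only [op_neg, op_one, neg_smul, one_smul, smul_neg]
  have hx : (4 : ℝ)⁻¹ • x + (4 : ℝ)⁻¹ • x + (4 : ℝ)⁻¹ • x + (4 : ℝ)⁻¹ • x = x := by module
  refine Eq.trans ?_ hx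
  abel

theorem stmt0 (X : Type*) [AddCommGroup X] [Module ℝ X]
    [Module ℍ X] [Module ℍᵐᵒᵖ X]
    [IsScalarTower ℝ ℍ X] [IsScalarTower ℝ ℍᵐᵒᵖ X]
    [SMulCommClass ℍ ℍᵐᵒᵖ X] :
    (∀ x : X, reMap X x ∈ reSet X) ∧
    (∀ x ∈ reSet X, reMap X x = x) ∧
    (∀ x : X, reMap X (reMap X x) = reMap X x) ∧
    Set.range (reMap X) = reSet X ∧
    (∀ x : X, x = ∑ e : Fin 4, op (qB e) • reMap X (star (qB e) • x)) := by
  refine ⟨reMap_mem_reSet, fun _ => reMap_eq_self, fun x => reMap_eq_self (reMap_mem_reSet x), ?_,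
    fun x => (sum_op_qB_smul_reMap x).symm⟩
  ext x
  exact ⟨fun ⟨y, hy⟩ => hy ▸ reMap_mem_reSet y, fun hx => ⟨x, reMap_eq_self hx⟩⟩
end

section
/- Let X and Y be ℍ-vector spaces. If T : X → Y is an ℍ-bimodule map (ℝ-linear with T(α • x • β) = α • T(x) • β for all α, β ∈ ℍ, x ∈ X), then T maps X_Re into Y_Re, and the restriction map Ψ : T ↦ T|_{X_Re} is an ℝ-linear bijection from the space of ℍ-bimodule maps X → Y onto the space of ℝ-linear maps X_Re → Y_Re. -/
open MulOpposite

local notation "ℍ" => Quaternion ℝ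

/-- The real part of an `ℍ`-vector space, as a real submodule. -/
def reSub (X : Type*) [AddCommGroup X] [Module ℝ X] [Module ℍ X] [Module ℍᵐᵒᵖ X]
    [IsScalarTower ℝ ℍ X] [IsScalarTower ℝ ℍᵐᵒᵖ X] : Submodule ℝ X where
  carrier := reSet X
  add_mem' := fun ha hb α => by rw [smul_add, smul_add, ha α, hb α]
  zero_mem' := fun α => by simp
  smul_mem' := fun r x hx α => by rw [smul_comm, hx α, smul_comm]

/-- The `ℝ`-submodule of `ℍ`-bimodule maps inside the `ℝ`-linear maps. -/
def bimodSub (X Y : Type*) [AddCommGroup X] [Module ℝ X] [Module ℍ X] [Module ℍᵐᵒᵖ X]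
    [AddCommGroup Y] [Module ℝ Y] [Module ℍ Y] [Module ℍᵐᵒᵖ Y]
    [IsScalarTower ℝ ℍ Y] [IsScalarTower ℝ ℍᵐᵒᵖ Y] :
    Submodule ℝ (X →ₗ[ℝ] Y) where
  carrier := {T | ∀ (α β : ℍ) (x : X), T (α • op β • x) = α • op β • T x}
  add_mem' := fun {S T} hS hT α β x => by
    simp [hS α β x, hT α β x, smul_add]
  zero_mem' := fun α β x => by simp
  smul_mem' := fun r T hT α β x => by
    simp only [LinearMap.smul_apply, hT α β x]
    rw [smul_comm r α, smul_comm r (op β)]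

theorem qB_eq (e : Fin 4) : qB e = ⟨if e = 0 then 1 else 0, if e = 1 then 1 else 0,
    if e = 2 then 1 else 0, if e = 3 then 1 else 0⟩ := by
  fin_cases e <;> rfl

theorem re_qB (e : Fin 4) : (qB e).re = if e = 0 then 1 else 0 := by rw [qB_eq]

theorem imI_qB (e : Fin 4) : (qB e).imI = if e = 1 then 1 else 0 := by rw [qB_eq]

theorem imJ_qB (e : Fin 4) : (qB e).imJ = if e = 2 then 1 else 0 := by rw [qB_eq]

theorem imK_qB (e : Fin 4) : (qB e).imK = if e = 3 then 1 else 0 := by rw [qB_eq]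

theorem sum_qB_mul_mul_star (q : ℍ) :
    ∑ e, qB e * q * star (qB e) = (4 * q.re) • (1 : ℍ) := by
  apply Quaternion.ext <;>
    simp [Fin.sum_univ_four, re_qB, imI_qB, imJ_qB, imK_qB, Quaternion.re_one,
      Quaternion.imI_one, Quaternion.imJ_one, Quaternion.imK_one] <;> ring

theorem sum_re_star_qB_mul_smul (q : ℍ) : ∑ e, (star (qB e) * q).re • qB e = q := by
  apply Quaternion.ext <;> simp [Fin.sum_univ_four, re_qB, imI_qB, imJ_qB, imK_qB]

theorem sum_re_mul_qB_smul_star (q : ℍ) : ∑ e, (q * qB e).re • star (qB e) = q := by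
  apply Quaternion.ext <;> simp [Fin.sum_univ_four, re_qB, imI_qB, imJ_qB, imK_qB]

section RealPart

variable {X : Type*} [AddCommGroup X] [Module ℝ X] [Module ℍ X] [Module ℍᵐᵒᵖ X]
  [IsScalarTower ℝ ℍ X] [IsScalarTower ℝ ℍᵐᵒᵖ X]

theorem op_smul_of_mem_reSub {y : X} (hy : y ∈ reSub X) (α : ℍ) : op α • y = α • y :=
  (hy α).symm

variable [SMulCommClass ℍ ℍᵐᵒᵖ X]

theorem smul_op_smul_smul_of_mem_reSub (α β q : ℍ) {y : X} (hy : y ∈ reSub X) :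
    α • op β • q • y = (α * (q * β)) • y := by
  rw [← smul_comm q (op β), op_smul_of_mem_reSub hy, smul_smul, smul_smul, mul_assoc]

theorem sum_qB_conj_mem_reSub (x : X) : ∑ e, qB e • op (star (qB e)) • x ∈ reSub X := by
  intro α
  have hl : ∀ e, α • qB e • op (star (qB e)) • x =
      ∑ f, (star (qB f) * (α * qB e)).re • qB f • op (star (qB e)) • x := by
    intro e
    rw [smul_smul]
    conv_lhs => rw [← sum_re_star_qB_mul_smul (α * qB e)]
    simp only [Finset.sum_smul, smul_assoc]
  have hr : ∀ e, op α • qB e • op (star (qB e)) • x =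
      ∑ f, (star (qB e) * α * qB f).re • qB e • op (star (qB f)) • x := by
    intro e
    rw [← smul_comm (qB e) (op α), smul_smul (op α), ← op_mul]
    conv_lhs => rw [← sum_re_mul_qB_smul_star (star (qB e) * α)]
    simp only [Finset.op_sum, op_smul, Finset.sum_smul, smul_assoc, Finset.smul_sum]
    exact Finset.sum_congr rfl fun f _ => smul_comm _ _ _
  simp only [Finset.smul_sum, hl, hr]
  rw [Finset.sum_comm]
  simp only [mul_assoc]

/-- The projection `x ↦ ¼ ∑ e x ē` of an `ℍ`-vector space onto its real part. -/
noncomputable def reProj (X : Type*) [AddCommGroup X] [Module ℝ X] [Module ℍ X] [Module ℍᵐᵒᵖ X]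
    [IsScalarTower ℝ ℍ X] [IsScalarTower ℝ ℍᵐᵒᵖ X] [SMulCommClass ℍ ℍᵐᵒᵖ X] :
    X →ₗ[ℝ] reSub X where
  toFun x := (4⁻¹ : ℝ) • ⟨∑ e, qB e • op (star (qB e)) • x, sum_qB_conj_mem_reSub x⟩
  map_add' x y := by
    ext
    simp [smul_add, Finset.sum_add_distrib]
  map_smul' r x := by
    ext
    simp only [SetLike.mk_smul_mk, RingHom.id_apply, Finset.smul_sum]
    refine Finset.sum_congr rfl fun e _ => ?_
    rw [smul_comm (op (star (qB e))) r x, smul_comm (qB e) r, smul_comm r (4⁻¹ : ℝ)]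

theorem coe_reProj (x : X) :
    (reProj X x : X) = (4⁻¹ : ℝ) • ∑ e, qB e • op (star (qB e)) • x := rfl

theorem reProj_smul_of_mem (q : ℍ) (y : reSub X) : reProj X (q • (y : X)) = q.re • y := by
  ext
  have h : ∀ e, qB e • op (star (qB e)) • q • (y : X) = (qB e * q * star (qB e)) • (y : X) := by
    intro e
    rw [← smul_comm q (op (star (qB e))), op_smul_of_mem_reSub y.2, smul_smul, smul_smul, mul_assoc]
  rw [coe_reProj]
  simp only [h]
  rw [← Finset.sum_smul, sum_qB_mul_mul_star, smul_assoc, one_smul, smul_smul]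
  simp

theorem sum_qB_smul_reProj (x : X) : ∑ e, qB e • (reProj X (star (qB e) • x) : X) = x := by
  have h : ∀ e f, qB e • qB f • op (star (qB f)) • star (qB e) • x =
      (qB e * qB f * star (qB e)) • op (star (qB f)) • x := by
    intro e f
    rw [← smul_comm (star (qB e)) (op (star (qB f))), smul_smul, smul_smul, mul_assoc]
  simp only [coe_reProj, smul_comm (_ : ℍ) (4⁻¹ : ℝ), ← Finset.smul_sum]
  simp only [Finset.smul_sum, h]
  rw [Finset.sum_comm]
  simp only [← Finset.smul_sum, ← Finset.sum_smul, sum_qB_mul_mul_star]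
  simp [Fin.sum_univ_four, qB, smul_smul, Quaternion.re_one]

end RealPart

section Extension

variable {X Y : Type*}
  [AddCommGroup X] [Module ℝ X] [Module ℍ X] [Module ℍᵐᵒᵖ X]
  [IsScalarTower ℝ ℍ X] [IsScalarTower ℝ ℍᵐᵒᵖ X]
  [AddCommGroup Y] [Module ℝ Y] [Module ℍ Y] [Module ℍᵐᵒᵖ Y]
  [IsScalarTower ℝ ℍ Y] [IsScalarTower ℝ ℍᵐᵒᵖ Y]

theorem map_mem_reSub {T : X →ₗ[ℝ] Y} (hT : T ∈ bimodSub X Y) {x : X} (hx : x ∈ reSub X) :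
    T x ∈ reSub Y := by
  intro α
  have hl := hT α 1 x
  have hr := hT 1 α x
  simp only [op_one, one_smul] at hl hr
  rw [← hl, ← hr, hx α]

variable (X Y) in
/-- Restriction of `ℍ`-bimodule maps to the real parts. -/
def reRestrict : bimodSub X Y →ₗ[ℝ] reSub X →ₗ[ℝ] reSub Y where
  toFun T := (T : X →ₗ[ℝ] Y).restrict fun _ hx => map_mem_reSub T.2 hx
  map_add' _ _ := rfl
  map_smul' _ _ := rfl

variable [SMulCommClass ℍ ℍᵐᵒᵖ X]

/-- The `ℍ`-bimodule extension of a real-linear map between real parts. -/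
noncomputable def reExtend (S : reSub X →ₗ[ℝ] reSub Y) : X →ₗ[ℝ] Y where
  toFun x := ∑ e, qB e • (S (reProj X (star (qB e) • x)) : Y)
  map_add' x y := by simp [smul_add, Finset.sum_add_distrib]
  map_smul' r x := by
    simp only [smul_comm _ r x, map_smul, Submodule.coe_smul, RingHom.id_apply, Finset.smul_sum]
    exact Finset.sum_congr rfl fun e _ => smul_comm _ _ _

theorem reExtend_smul_of_mem (S : reSub X →ₗ[ℝ] reSub Y) (q : ℍ) (y : reSub X) :
    reExtend S (q • (y : X)) = q • (S y : Y) := by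
  change ∑ e, qB e • (S (reProj X (star (qB e) • q • (y : X))) : Y) = _
  conv_rhs => rw [← sum_re_star_qB_mul_smul q]
  rw [Finset.sum_smul]
  refine Finset.sum_congr rfl fun e _ => ?_
  rw [smul_smul, reProj_smul_of_mem, map_smul, Submodule.coe_smul, smul_assoc, smul_comm]

theorem reExtend_mem_bimodSub [SMulCommClass ℍ ℍᵐᵒᵖ Y] (S : reSub X →ₗ[ℝ] reSub Y) :
    reExtend S ∈ bimodSub X Y := by
  intro α β x
  conv_lhs => rw [← sum_qB_smul_reProj x]
  conv_rhs => rw [← sum_qB_smul_reProj x]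
  simp only [Finset.smul_sum, map_sum, smul_op_smul_smul_of_mem_reSub _ _ _ (Subtype.prop _),
    reExtend_smul_of_mem]

end Extension

theorem stmt1 (X Y : Type*)
    [AddCommGroup X] [Module ℝ X] [Module ℍ X] [Module ℍᵐᵒᵖ X]
    [IsScalarTower ℝ ℍ X] [IsScalarTower ℝ ℍᵐᵒᵖ X] [SMulCommClass ℍ ℍᵐᵒᵖ X]
    [AddCommGroup Y] [Module ℝ Y] [Module ℍ Y] [Module ℍᵐᵒᵖ Y]
    [IsScalarTower ℝ ℍ Y] [IsScalarTower ℝ ℍᵐᵒᵖ Y] [SMulCommClass ℍ ℍᵐᵒᵖ Y] :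
    (∀ T : X →ₗ[ℝ] Y, (∀ (α β : ℍ) (x : X), T (α • op β • x) = α • op β • T x) →
      ∀ x ∈ reSub X, T x ∈ reSub Y) ∧
    ∃ Ψ : ↥(bimodSub X Y) →ₗ[ℝ] (↥(reSub X) →ₗ[ℝ] ↥(reSub Y)),
      (∀ (T : ↥(bimodSub X Y)) (x : ↥(reSub X)), ((Ψ T) x : Y) = (T : X →ₗ[ℝ] Y) x) ∧
      Function.Bijective Ψ := by
  refine ⟨fun T hT x hx => map_mem_reSub hT hx, reRestrict X Y, fun _ _ => rfl, ?_, ?_⟩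
  · intro T T' h
    ext x
    have hS : ∀ y : reSub X, (T : X →ₗ[ℝ] Y) y = (T' : X →ₗ[ℝ] Y) y := fun y =>
      congrArg Subtype.val (LinearMap.congr_fun h y)
    have hl : ∀ (T : bimodSub X Y) (q : ℍ) (x : X),
        (T : X →ₗ[ℝ] Y) (q • x) = q • (T : X →ₗ[ℝ] Y) x := fun T q x => by
      simpa using T.2 q 1 x
    rw [← sum_qB_smul_reProj x]
    simp only [map_sum, hl, hS]
  · intro S
    refine ⟨⟨reExtend S, reExtend_mem_bimodSub S⟩, ?_⟩
    ext y
    change reExtend S (y : X) = _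
    simpa using reExtend_smul_of_mem S 1 y
end

section
/- Let X be an ℍ-vector space and let α = a·i + b·j + c·k ∈ ℍ with a, b, c ∈ ℝ and a² + b² + c² = 1. Then α² = -1, ‖α‖ = 1, and the set X_{1,α} := {x ∈ X : α • x = x • α} equals X_Re + α • X_Re, i.e. x satisfies α • x = x • α if and only if x = x₀ + α • x₁ for some x₀, x₁ ∈ X_Re. -/
open MulOpposite

local notation "ℍ" => Quaternion ℝ

/-- The commutation relation with a fixed vector is closed under products. -/
theorem mul_smul_eq_op_smul {X : Type*} [AddCommGroup X] [Module ℍ X] [Module ℍᵐᵒᵖ X]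
    [SMulCommClass ℍ ℍᵐᵒᵖ X] {p q : ℍ} {x : X}
    (hp : p • x = op p • x) (hq : q • x = op q • x) :
    (p * q) • x = op (p * q) • x := by
  rw [mul_smul, hq, smul_comm, hp, op_mul, mul_smul]

/-- A unit imaginary quaternion squares to `-1`. -/
theorem mul_self_eq_neg_one {q : ℍ} (h₀ : q.re = 0)
    (h : q.imI ^ 2 + q.imJ ^ 2 + q.imK ^ 2 = 1) : q * q = -1 := by
  apply Quaternion.ext <;>
    simp only [Quaternion.re_neg, Quaternion.imI_neg, Quaternion.imJ_neg, Quaternion.imK_neg,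
      Quaternion.re_one, Quaternion.imI_one, Quaternion.imJ_one, Quaternion.imK_one,
      Quaternion.re_mul, Quaternion.imI_mul, Quaternion.imJ_mul, Quaternion.imK_mul, h₀] <;>
    linarith

/-- Orthogonal imaginary quaternions anticommute. -/
theorem mul_eq_neg_mul_of_orthogonal {p q : ℍ} (hp : p.re = 0) (hq : q.re = 0)
    (h : p.imI * q.imI + p.imJ * q.imJ + p.imK * q.imK = 0) : q * p = -(p * q) := by
  apply Quaternion.ext <;>
    simp only [Quaternion.re_neg, Quaternion.imI_neg, Quaternion.imJ_neg, Quaternion.imK_neg,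
      Quaternion.re_mul, Quaternion.imI_mul, Quaternion.imJ_mul, Quaternion.imK_mul, hp, hq] <;>
    linarith

/-- A unit imaginary quaternion has an anticommuting imaginary unit, and the two generate `ℍ`. -/
theorem exists_anticommuting_unit {α : ℍ} (hα : α.re = 0)
    (h : α.imI ^ 2 + α.imJ ^ 2 + α.imK ^ 2 = 1) :
    ∃ β : ℍ, β * β = -1 ∧ β * α = -(α * β) ∧
      ∀ q : ℍ, ∃ r s t u : ℝ, q = r • 1 + s • α + t • β + u • (α * β) := by
  by_cases hs : α.imI ^ 2 + α.imJ ^ 2 = 0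
  · have ha : α.imI = 0 := by nlinarith [sq_nonneg α.imI, sq_nonneg α.imJ]
    have hb : α.imJ = 0 := by nlinarith [sq_nonneg α.imI, sq_nonneg α.imJ]
    have hc : α.imK * α.imK = 1 := by nlinarith
    obtain ⟨β, h₀, h₁, h₂, h₃⟩ : ∃ β : ℍ, β.re = 0 ∧ β.imI = 1 ∧ β.imJ = 0 ∧ β.imK = 0 :=
      ⟨⟨0, 1, 0, 0⟩, rfl, rfl, rfl, rfl⟩
    refine ⟨β, mul_self_eq_neg_one h₀ (by simp [h₁, h₂, h₃]),
      mul_eq_neg_mul_of_orthogonal hα h₀ (by simp [ha, h₂, h₃]),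
      fun q => ⟨q.re, α.imK * q.imK, q.imI, α.imK * q.imJ, ?_⟩⟩
    apply Quaternion.ext <;>
      simp only [Quaternion.re_add, Quaternion.imI_add, Quaternion.imJ_add, Quaternion.imK_add,
        Quaternion.re_one, Quaternion.imI_one, Quaternion.imJ_one, Quaternion.imK_one,
        Quaternion.re_mul, Quaternion.imI_mul, Quaternion.imJ_mul, Quaternion.imK_mul,
        Quaternion.re_smul, Quaternion.imI_smul, Quaternion.imJ_smul, Quaternion.imK_smul, smul_eq_mul,
        h₀, h₁, h₂, h₃, hα, ha, hb]
    · ring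
    · ring
    · linear_combination -q.imJ * hc
    · linear_combination -q.imK * hc
  · have hpos : 0 < α.imI ^ 2 + α.imJ ^ 2 := lt_of_le_of_ne (by positivity) (Ne.symm hs)
    obtain ⟨s, hs0, hs2⟩ : ∃ s : ℝ, s ≠ 0 ∧ s ^ 2 = α.imI ^ 2 + α.imJ ^ 2 :=
      ⟨√(α.imI ^ 2 + α.imJ ^ 2), (Real.sqrt_pos.2 hpos).ne', Real.sq_sqrt hpos.le⟩
    obtain ⟨β, h₀, h₁, h₂, h₃⟩ : ∃ β : ℍ, β.re = 0 ∧ β.imI = α.imJ / s ∧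
        β.imJ = -α.imI / s ∧ β.imK = 0 :=
      ⟨⟨0, α.imJ / s, -α.imI / s, 0⟩, rfl, rfl, rfl, rfl⟩
    refine ⟨β, mul_self_eq_neg_one h₀ ?_, mul_eq_neg_mul_of_orthogonal hα h₀ ?_,
      fun q => ⟨q.re, α.imI * q.imI + α.imJ * q.imJ + α.imK * q.imK,
        (α.imJ * q.imI - α.imI * q.imJ) / s,
        (α.imK * α.imI * q.imI + α.imK * α.imJ * q.imJ - s ^ 2 * q.imK) / s, ?_⟩⟩
    · rw [h₁, h₂, h₃]
      field_simp
      linarith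
    · rw [h₁, h₂, h₃]
      ring
    · apply Quaternion.ext <;>
        simp only [Quaternion.re_add, Quaternion.imI_add, Quaternion.imJ_add, Quaternion.imK_add,
          Quaternion.re_one, Quaternion.imI_one, Quaternion.imJ_one, Quaternion.imK_one,
          Quaternion.re_mul, Quaternion.imI_mul, Quaternion.imJ_mul, Quaternion.imK_mul,
          Quaternion.re_smul, Quaternion.imI_smul, Quaternion.imJ_smul, Quaternion.imK_smul, smul_eq_mul,
          h₀, h₁, h₂, h₃, hα] <;>
        generalize α.imI = a at * <;> generalize α.imJ = b at * <;> generalize α.imK = c at * <;>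
        generalize q.imI = x at * <;> generalize q.imJ = y at * <;> generalize q.imK = z at * <;>
        field_simp
      · ring
      · rw [hs2]
        linear_combination -(x * a + y * b) * a * h
      · rw [hs2]
        linear_combination -(x * a + y * b) * b * h
      · rw [hs2]
        linear_combination -z * (a ^ 2 + b ^ 2) * h -
          c * (z * c + a * x + b * y) * hs2

theorem stmt2 (X : Type*)
    [AddCommGroup X] [Module ℝ X] [Module ℍ X] [Module ℍᵐᵒᵖ X]
    [IsScalarTower ℝ ℍ X] [IsScalarTower ℝ ℍᵐᵒᵖ X] [SMulCommClass ℍ ℍᵐᵒᵖ X]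
    (a b c : ℝ) (h : a ^ 2 + b ^ 2 + c ^ 2 = 1)
    (α : ℍ) (hα : α = ⟨0, a, b, c⟩) :
    α * α = -1 ∧ ‖α‖ = 1 ∧
    ∀ x : X, (α • x = op α • x ↔
      ∃ x₀ ∈ reSet X, ∃ x₁ ∈ reSet X, x = x₀ + α • x₁) := by
  obtain ⟨hre, hI, hJ, hK⟩ : α.re = 0 ∧ α.imI = a ∧ α.imJ = b ∧ α.imK = c := by
    subst hα
    exact ⟨rfl, rfl, rfl, rfl⟩
  rw [← hI, ← hJ, ← hK] at h
  have hαα := mul_self_eq_neg_one hre h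
  refine ⟨hαα, ?_, fun x => ⟨fun hx => ?_, ?_⟩⟩
  · have hn : ‖α‖ * ‖α‖ = 1 := by rw [← norm_mul, hαα, norm_neg, norm_one]
    nlinarith [norm_nonneg α]
  · obtain ⟨β, hββ, hβα, hspan⟩ := exists_anticommuting_unit hre h
    have hmem : ∀ y : X, α • y = op α • y → β • y = op β • y → y ∈ reSet X := by
      intro y hyα hyβ q
      obtain ⟨r, s, t, u, rfl⟩ := hspan q
      have hyαβ := mul_smul_eq_op_smul hyα hyβ
      simp only [add_smul, op_add, op_smul, smul_assoc, op_one, one_smul, hyα, hyβ, hyαβ]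
    have hLα (y : X) : α • α • y = -y := by rw [← mul_smul, hαα, neg_one_smul]
    have hLβ (y : X) : β • β • y = -y := by rw [← mul_smul, hββ, neg_one_smul]
    have hRβ (y : X) : op β • op β • y = -y := by
      rw [← mul_smul, ← op_mul, hββ, op_neg, op_one, neg_one_smul]
    have hL (y : X) : β • α • y = -(α • β • y) := by
      rw [← mul_smul, hβα, neg_smul, mul_smul]
    have hR (y : X) : op α • op β • y = -(op β • op α • y) := by
      rw [← mul_smul, ← op_mul, hβα, op_neg, op_mul, neg_smul, mul_smul]
    have hLR (p q : ℍ) (y : X) : op p • q • y = q • op p • y := (smul_comm q (op p) y).symm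
    have hrL (r : ℝ) (q : ℍ) (y : X) : q • r • y = r • q • y := smul_comm _ _ _
    have hrR (r : ℝ) (q : ℍ) (y : X) : op q • r • y = r • op q • y := smul_comm _ _ _
    refine ⟨(1 / 2 : ℝ) • (x - β • op β • x), hmem _ ?_ ?_,
      (1 / 2 : ℝ) • -(α • (x + β • op β • x)), hmem _ ?_ ?_, ?_⟩
    all_goals
      simp only [hrL, hrR, smul_sub, smul_add, smul_neg, hLR, hL, hR, hLα, hLβ, hRβ, ← hx]
    on_goal 5 =>
      generalize β • op β • x = y
      module
    all_goals abel
  · rintro ⟨x₀, h₀, x₁, h₁, rfl⟩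
    rw [smul_add, smul_add, h₀ α, ← smul_comm α (op α) x₁, ← h₁ α]
end

section
/- Let X be an ℍ-normed space. Then the bounded ℍ-bimodule maps from X to ℍ separate the points of X: for every nonzero x ∈ X there exists a bounded ℝ-linear map T : X → ℍ satisfying T(α • y • β) = α T(y) β for all α, β ∈ ℍ and y ∈ X, such that T(x) ≠ 0. -/
open MulOpposite

local notation "ℍ" => Quaternion ℝ

attribute [local simp] Quaternion.re_zero Quaternion.imI_zero Quaternion.imJ_zero
  Quaternion.imK_zero Quaternion.re_one Quaternion.imI_one Quaternion.imJ_one Quaternion.imK_one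

namespace QuaternionBimodule

/-- The imaginary unit `i`. -/
noncomputable def unitI : ℍ := ⟨0, 1, 0, 0⟩

/-- The imaginary unit `j`. -/
noncomputable def unitJ : ℍ := ⟨0, 0, 1, 0⟩

/-- The imaginary unit `k`. -/
noncomputable def unitK : ℍ := ⟨0, 0, 0, 1⟩

@[simp] theorem re_unitI : unitI.re = 0 := rfl
@[simp] theorem imI_unitI : unitI.imI = 1 := rfl
@[simp] theorem imJ_unitI : unitI.imJ = 0 := rfl
@[simp] theorem imK_unitI : unitI.imK = 0 := rfl
@[simp] theorem re_unitJ : unitJ.re = 0 := rfl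
@[simp] theorem imI_unitJ : unitJ.imI = 0 := rfl
@[simp] theorem imJ_unitJ : unitJ.imJ = 1 := rfl
@[simp] theorem imK_unitJ : unitJ.imK = 0 := rfl
@[simp] theorem re_unitK : unitK.re = 0 := rfl
@[simp] theorem imI_unitK : unitK.imI = 0 := rfl
@[simp] theorem imJ_unitK : unitK.imJ = 0 := rfl
@[simp] theorem imK_unitK : unitK.imK = 1 := rfl

theorem eq_combination (q : ℍ) :
    q = q.re • (1 : ℍ) + q.imI • unitI + q.imJ • unitJ + q.imK • unitK := by
  ext <;> simp

theorem map_eq_combination {M : Type*} [AddCommGroup M] [Module ℝ M] (φ : ℍ →ₗ[ℝ] M) (q : ℍ) :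
    φ q = q.re • φ 1 + q.imI • φ unitI + q.imJ • φ unitJ + q.imK • φ unitK := by
  conv_lhs => rw [eq_combination q]
  simp only [map_add, map_smul]

theorem unitI_mul_unitI : unitI * unitI = -1 := by ext <;> simp
theorem unitJ_mul_unitJ : unitJ * unitJ = -1 := by ext <;> simp
theorem unitK_mul_unitK : unitK * unitK = -1 := by ext <;> simp
theorem unitI_mul_unitJ : unitI * unitJ = unitK := by ext <;> simp
theorem unitJ_mul_unitI : unitJ * unitI = -unitK := by ext <;> simp
theorem unitJ_mul_unitK : unitJ * unitK = unitI := by ext <;> simp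
theorem unitK_mul_unitJ : unitK * unitJ = -unitI := by ext <;> simp
theorem unitK_mul_unitI : unitK * unitI = unitJ := by ext <;> simp
theorem unitI_mul_unitK : unitI * unitK = -unitJ := by ext <;> simp

section Algebraic

variable {X : Type*} [AddCommGroup X] [Module ℍ X] [Module ℍᵐᵒᵖ X]

/-- Four times the projection of a quaternionic bimodule onto its real part. -/
noncomputable def realPart (x : X) : X :=
  x - unitI • op unitI • x - unitJ • op unitJ • x - unitK • op unitK • x

end Algebraic

section Extend

variable {X : Type*} [SMul ℍ X]

/-- The quaternion-valued map with real part `g`. -/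
noncomputable def extend (g : X → ℝ) (y : X) : ℍ :=
  ⟨g y, -g (unitI • y), -g (unitJ • y), -g (unitK • y)⟩

@[simp] theorem re_extend (g : X → ℝ) (y : X) : (extend g y).re = g y := rfl
@[simp] theorem imI_extend (g : X → ℝ) (y : X) : (extend g y).imI = -g (unitI • y) := rfl
@[simp] theorem imJ_extend (g : X → ℝ) (y : X) : (extend g y).imJ = -g (unitJ • y) := rfl
@[simp] theorem imK_extend (g : X → ℝ) (y : X) : (extend g y).imK = -g (unitK • y) := rfl

end Extend

theorem extend_smul {X : Type*} [AddCommGroup X] [Module ℝ X] [Module ℍ X] [IsScalarTower ℝ ℍ X]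
    (g : X →ₗ[ℝ] ℝ) (α : ℍ) (y : X) :
    extend g (α • y) = α * extend g y := by
  let φ : ℍ →ₗ[ℝ] ℝ := g ∘ₗ (LinearMap.toSpanSingleton ℍ X y).restrictScalars ℝ
  have hφ (q : ℍ) : g (q • y) = φ q := rfl
  have h1 : g y = φ 1 := by rw [← hφ, one_smul]
  ext
  · simp [hφ, h1, map_eq_combination φ α]
  · simp [← mul_smul, hφ, h1, map_eq_combination φ (unitI * α)]
    ring
  · simp [← mul_smul, hφ, h1, map_eq_combination φ (unitJ * α)]
    ring
  · simp [← mul_smul, hφ, h1, map_eq_combination φ (unitK * α)]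
    ring

section Algebraic

variable {X : Type*} [AddCommGroup X] [Module ℝ X] [Module ℍ X] [Module ℍᵐᵒᵖ X]

theorem realPart_op_smul [IsScalarTower ℝ ℍ X] [IsScalarTower ℝ ℍᵐᵒᵖ X] [SMulCommClass ℍ ℍᵐᵒᵖ X]
    (β : ℍ) (x : X) : realPart (op β • x) = realPart (β • x) := by
  have hop (a b : ℍ) (z : X) : op a • b • z = b • op a • z := (smul_comm b (op a) z).symm
  have hr (r : ℝ) (a : ℍ) (z : X) : a • r • z = r • a • z := smul_comm a r z
  have hro (r : ℝ) (a : ℍ) (z : X) : op a • r • z = r • op a • z := smul_comm (op a) r z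
  have hll (a b : ℍ) (z : X) : a • b • z = (a * b) • z := (mul_smul a b z).symm
  have hrr (a b : ℍ) (z : X) : op a • op b • z = op (b * a) • z := by
    rw [op_mul, mul_smul]
  rw [eq_combination β]
  simp only [realPart, op_add, op_smul, op_one, add_smul, smul_assoc, one_smul, smul_add, hr, hro,
    hop, hll, hrr, unitI_mul_unitI, unitJ_mul_unitJ, unitK_mul_unitK, unitI_mul_unitJ,
    unitJ_mul_unitI, unitJ_mul_unitK, unitK_mul_unitJ, unitK_mul_unitI, unitI_mul_unitK,
    op_neg, neg_smul, smul_neg]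
  -- `module` only normalizes scalars from commutative rings, so hide the quaternionic ones.
  obtain ⟨l, hl⟩ : ∃ l : ℍ → X → X, ∀ a z, a • z = l a z := ⟨_, fun _ _ => rfl⟩
  obtain ⟨r, hr⟩ : ∃ r : ℍ → X → X, ∀ a z, op a • z = r a z := ⟨_, fun _ _ => rfl⟩
  simp only [hl, hr]
  module

theorem sum_smul_realPart [IsScalarTower ℝ ℍ X] [SMulCommClass ℍ ℍᵐᵒᵖ X] (x : X) :
    realPart x - unitI • realPart (unitI • x) - unitJ • realPart (unitJ • x)
      - unitK • realPart (unitK • x) = (4 : ℝ) • x := by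
  have hop (a b : ℍ) (z : X) : op a • b • z = b • op a • z := (smul_comm b (op a) z).symm
  have hll (a b : ℍ) (z : X) : a • b • z = (a * b) • z := (mul_smul a b z).symm
  simp only [realPart, one_smul, smul_sub,
    hop, hll, unitI_mul_unitI, unitJ_mul_unitJ, unitK_mul_unitK, unitI_mul_unitJ,
    unitJ_mul_unitI, unitJ_mul_unitK, unitK_mul_unitJ, unitK_mul_unitI, unitI_mul_unitK,
    neg_smul, smul_neg, neg_neg]
  -- `module` only normalizes scalars from commutative rings, so hide the quaternionic ones.
  obtain ⟨l, hl⟩ : ∃ l : ℍ → X → X, ∀ a z, a • z = l a z := ⟨_, fun _ _ => rfl⟩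
  obtain ⟨r, hr⟩ : ∃ r : ℍ → X → X, ∀ a z, op a • z = r a z := ⟨_, fun _ _ => rfl⟩
  simp only [hl, hr]
  module

theorem extend_op_smul [IsScalarTower ℝ ℍ X] [SMulCommClass ℍ ℍᵐᵒᵖ X] (g : X →ₗ[ℝ] ℝ)
    (hg : ∀ (β : ℍ) (y : X), g (op β • y) = g (β • y)) (β : ℍ) (y : X) :
    extend g (op β • y) = extend g y * β := by
  let φ : ℍ →ₗ[ℝ] ℝ := g ∘ₗ (LinearMap.toSpanSingleton ℍ X y).restrictScalars ℝ
  have hφ (q : ℍ) : g (q • y) = φ q := rfl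
  have h1 : g y = φ 1 := by rw [← hφ, one_smul]
  have hc (a : ℍ) : a • op β • y = op β • a • y := smul_comm _ _ _
  ext
  · simp [hg, hφ, h1, map_eq_combination φ β]
    ring
  · simp [hc, hg, ← mul_smul, hφ, h1, map_eq_combination φ (β * unitI)]
    ring
  · simp [hc, hg, ← mul_smul, hφ, h1, map_eq_combination φ (β * unitJ)]
    ring
  · simp [hc, hg, ← mul_smul, hφ, h1, map_eq_combination φ (β * unitK)]
    ring

theorem exists_realPart_ne_zero [IsScalarTower ℝ ℍ X] [SMulCommClass ℍ ℍᵐᵒᵖ X] {x : X} (hx : x ≠ 0) :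
    realPart x ≠ 0 ∨ realPart (unitI • x) ≠ 0 ∨ realPart (unitJ • x) ≠ 0 ∨
      realPart (unitK • x) ≠ 0 := by
  by_contra! h
  obtain ⟨h1, hi, hj, hk⟩ := h
  have := sum_smul_realPart x
  simp only [h1, hi, hj, hk, smul_zero, sub_zero] at this
  exact hx ((smul_eq_zero.mp this.symm).resolve_left (by norm_num))

end Algebraic

end QuaternionBimodule

open QuaternionBimodule in
theorem stmt6 (X : Type*)
    [NormedAddCommGroup X] [NormedSpace ℝ X] [Module ℍ X] [Module ℍᵐᵒᵖ X]
    [IsScalarTower ℝ ℍ X] [IsScalarTower ℝ ℍᵐᵒᵖ X] [SMulCommClass ℍ ℍᵐᵒᵖ X]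
    (hb : ∀ (α β : ℍ) (x : X), ‖α • op β • x‖ ≤ ‖α‖ * ‖x‖ * ‖β‖)
    (x : X) (hx : x ≠ 0) :
    ∃ T : X →L[ℝ] ℍ,
      (∀ (α β : ℍ) (y : X), T (α • op β • y) = α * T y * β) ∧ T x ≠ 0 := by
  let A (α β : ℍ) : X →L[ℝ] X := LinearMap.mkContinuous
    { toFun := fun y => α • op β • y
      map_add' := fun y z => by simp only [smul_add]
      map_smul' := fun r y => by
        rw [smul_comm (op β) r y, smul_comm α r, RingHom.id_apply] } (‖α‖ * ‖β‖)
    (fun y => (hb α β y).trans_eq (by ring))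
  let R : X →L[ℝ] X :=
    ContinuousLinearMap.id ℝ X - A unitI unitI - A unitJ unitJ - A unitK unitK
  have hR (y : X) : R y = realPart y := rfl
  have hL (α : ℍ) (y : X) : A α 1 y = α • y := by
    change α • op (1 : ℍ) • y = α • y
    rw [op_one, one_smul]
  obtain ⟨e, he⟩ : ∃ f : X →L[ℝ] ℝ, f (R x) ≠ 0 ∨ f (R (unitI • x)) ≠ 0 ∨
      f (R (unitJ • x)) ≠ 0 ∨ f (R (unitK • x)) ≠ 0 := by
    have sep {z : X} (hz : z ≠ 0) : ∃ f : X →L[ℝ] ℝ, f z ≠ 0 :=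
      SeparatingDual.exists_ne_zero hz
    rcases exists_realPart_ne_zero hx with h | h | h | h <;> obtain ⟨f, hf⟩ := sep h <;>
      exact ⟨f, by simp only [hR]; tauto⟩
  let g : X →L[ℝ] ℝ := e.comp R
  have hg (β : ℍ) (y : X) : g (op β • y) = g (β • y) :=
    congrArg e (realPart_op_smul β y)
  let T : X →L[ℝ] ℍ := g.smulRight 1 - (g.comp (A unitI 1)).smulRight unitI
    - (g.comp (A unitJ 1)).smulRight unitJ - (g.comp (A unitK 1)).smulRight unitK
  have hT (y : X) : T y = extend (g : X →ₗ[ℝ] ℝ) y := by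
    ext <;> simp [T, hL]
  refine ⟨T, fun α β y => ?_, fun h => ?_⟩
  · rw [hT, hT, extend_smul, extend_op_smul (g : X →ₗ[ℝ] ℝ) hg, mul_assoc]
  · rw [hT] at h
    have h1 := congrArg QuaternionAlgebra.re h
    have h2 := congrArg QuaternionAlgebra.imI h
    have h3 := congrArg QuaternionAlgebra.imJ h
    have h4 := congrArg QuaternionAlgebra.imK h
    simp [g] at h1 h2 h3 h4
    tauto
end

section
/- (Hahn–Banach theorem for quaternion functionals) Let X be an ℍ-normed space and let Y ⊆ X be an ℍ-sub-bimodule (a real subspace closed under both quaternion actions). For any bounded ℝ-linear map g : Y → ℍ satisfying g(α • y • β) = α g(y) β for all α, β ∈ ℍ, y ∈ Y, there exists a bounded ℝ-linear map ḡ : X → ℍ satisfying ḡ(α • x • β) = α ḡ(x) β for all α, β ∈ ℍ, x ∈ X, such that ḡ restricted to Y equals g and the operator norm of ḡ equals the operator norm of g. -/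
open MulOpposite

local notation "ℍ" => Quaternion ℝ

namespace QuaternionHahnBanach

@[simp] lemma re_one_real : (1 : ℍ).re = 1 := rfl
@[simp] lemma imI_one_real : (1 : ℍ).imI = 0 := rfl
@[simp] lemma imJ_one_real : (1 : ℍ).imJ = 0 := rfl
@[simp] lemma imK_one_real : (1 : ℍ).imK = 0 := rfl

/-- The imaginary unit `i`. -/
def unitI : ℍ := ⟨0, 1, 0, 0⟩

/-- The imaginary unit `j`. -/
def unitJ : ℍ := ⟨0, 0, 1, 0⟩

/-- The imaginary unit `k`. -/
def unitK : ℍ := ⟨0, 0, 0, 1⟩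

@[simp] lemma re_unitI : unitI.re = 0 := rfl
@[simp] lemma imI_unitI : unitI.imI = 1 := rfl
@[simp] lemma imJ_unitI : unitI.imJ = 0 := rfl
@[simp] lemma imK_unitI : unitI.imK = 0 := rfl
@[simp] lemma re_unitJ : unitJ.re = 0 := rfl
@[simp] lemma imI_unitJ : unitJ.imI = 0 := rfl
@[simp] lemma imJ_unitJ : unitJ.imJ = 1 := rfl
@[simp] lemma imK_unitJ : unitJ.imK = 0 := rfl
@[simp] lemma re_unitK : unitK.re = 0 := rfl
@[simp] lemma imI_unitK : unitK.imI = 0 := rfl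
@[simp] lemma imJ_unitK : unitK.imJ = 0 := rfl
@[simp] lemma imK_unitK : unitK.imK = 1 := rfl

@[simp] lemma unitI_mul_unitI : unitI * unitI = -1 := by ext <;> simp
@[simp] lemma unitJ_mul_unitJ : unitJ * unitJ = -1 := by ext <;> simp
@[simp] lemma unitK_mul_unitK : unitK * unitK = -1 := by ext <;> simp
@[simp] lemma unitI_mul_unitJ : unitI * unitJ = unitK := by ext <;> simp
@[simp] lemma unitJ_mul_unitK : unitJ * unitK = unitI := by ext <;> simp
@[simp] lemma unitK_mul_unitI : unitK * unitI = unitJ := by ext <;> simp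
@[simp] lemma unitJ_mul_unitI : unitJ * unitI = -unitK := by ext <;> simp
@[simp] lemma unitK_mul_unitJ : unitK * unitJ = -unitI := by ext <;> simp
@[simp] lemma unitI_mul_unitK : unitI * unitK = -unitJ := by ext <;> simp

lemma norm_unitI : ‖unitI‖ = 1 := by
  have h : ‖unitI‖ * ‖unitI‖ = 1 := by rw [← norm_mul]; simp
  nlinarith [norm_nonneg unitI]

lemma norm_unitJ : ‖unitJ‖ = 1 := by
  have h : ‖unitJ‖ * ‖unitJ‖ = 1 := by rw [← norm_mul]; simp
  nlinarith [norm_nonneg unitJ]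

lemma norm_unitK : ‖unitK‖ = 1 := by
  have h : ‖unitK‖ * ‖unitK‖ = 1 := by rw [← norm_mul]; simp
  nlinarith [norm_nonneg unitK]

lemma eq_sum_units (α : ℍ) :
    α = α.re • (1 : ℍ) + α.imI • unitI + α.imJ • unitJ + α.imK • unitK := by
  ext <;> simp

lemma ext_re_mul {p q : ℍ} (h : ∀ γ : ℍ, (γ * p).re = (γ * q).re) : p = q := by
  have h1 := h 1
  have hi := h unitI
  have hj := h unitJ
  have hk := h unitK
  simp at h1 hi hj hk
  ext <;> assumption

lemma re_mul_comm (p q : ℍ) : (p * q).re = (q * p).re := by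
  simp only [Quaternion.re_mul]; ring

lemma re_le_norm (p : ℍ) : |p.re| ≤ ‖p‖ := by
  apply abs_le_of_sq_le_sq _ (norm_nonneg p)
  rw [pow_two ‖p‖, ← Quaternion.normSq_eq_norm_mul_self, Quaternion.normSq_def']
  nlinarith [sq_nonneg p.imI, sq_nonneg p.imJ, sq_nonneg p.imK]

section LeftModule

variable {X : Type*} [AddCommGroup X] [Module ℝ X] [Module ℍ X] [IsScalarTower ℝ ℍ X]

lemma map_smul_eq (f : X →ₗ[ℝ] ℝ) (α : ℍ) (x : X) :
    f (α • x) = α.re * f x + α.imI * f (unitI • x) + α.imJ * f (unitJ • x)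
      + α.imK * f (unitK • x) := by
  conv_lhs => rw [eq_sum_units α]
  simp only [add_smul, smul_assoc, one_smul, map_add, map_smul, smul_eq_mul]

/-- The left `ℍ`-linear map whose real part is the given real functional. -/
noncomputable def toQuaternion (f : X →ₗ[ℝ] ℝ) : X →ₗ[ℝ] ℍ where
  toFun x := f x • (1 : ℍ) - f (unitI • x) • unitI - f (unitJ • x) • unitJ - f (unitK • x) • unitK
  map_add' x y := by
    simp only [smul_add, map_add, add_smul]; abel
  map_smul' r x := by
    simp only [smul_comm _ r x, map_smul, smul_eq_mul, mul_smul, smul_sub, RingHom.id_apply]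

lemma re_mul_toQuaternion (f : X →ₗ[ℝ] ℝ) (γ : ℍ) (x : X) :
    (γ * toQuaternion f x).re = f (γ • x) := by
  rw [map_smul_eq]
  simp [toQuaternion]

lemma norm_toQuaternion_le (f : X →ₗ[ℝ] ℝ) {C : ℝ} {x : X}
    (hf : ∀ α : ℍ, |f (α • x)| ≤ C * ‖α‖) : ‖toQuaternion f x‖ ≤ C := by
  set q := toQuaternion f x with hq
  have h1 : ‖q‖ * ‖q‖ = f (star q • x) := by
    rw [← re_mul_toQuaternion, ← hq, Quaternion.star_mul_self, Quaternion.re_coe,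
      Quaternion.normSq_eq_norm_mul_self]
  have h2 := (le_abs_self _).trans (hf (star q))
  rw [norm_star, ← h1] at h2
  by_cases h0 : ‖q‖ = 0
  · have := (abs_nonneg _).trans (hf 1)
    rw [norm_one, mul_one] at this
    rwa [h0]
  · exact le_of_mul_le_mul_right h2 (lt_of_le_of_ne (norm_nonneg _) (Ne.symm h0))

lemma toQuaternion_bimodule_map [Module ℍᵐᵒᵖ X] [SMulCommClass ℍ ℍᵐᵒᵖ X] (f : X →ₗ[ℝ] ℝ)
    (hf : ∀ (α : ℍ) (x : X), f (α • x) = f (op α • x)) (α β : ℍ) (x : X) :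
    toQuaternion f (α • op β • x) = α * toQuaternion f x * β := by
  refine ext_re_mul fun γ => ?_
  rw [re_mul_toQuaternion, ← mul_assoc, re_mul_comm, ← mul_assoc, ← mul_assoc,
    re_mul_toQuaternion, smul_smul, smul_comm, ← hf, smul_smul, mul_assoc]

end LeftModule

section Bimodule

variable {X : Type*} [AddCommGroup X] [Module ℝ X] [Module ℍ X] [Module ℍᵐᵒᵖ X]
  [IsScalarTower ℝ ℍ X] [IsScalarTower ℝ ℍᵐᵒᵖ X]

/-- The average of a real functional over conjugation by `1, i, j, k`. -/
noncomputable def conjAverage (φ : X →ₗ[ℝ] ℝ) : X →ₗ[ℝ] ℝ where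
  toFun x := (φ x - φ (unitI • op unitI • x) - φ (unitJ • op unitJ • x)
    - φ (unitK • op unitK • x)) / 4
  map_add' x y := by simp only [smul_add, map_add]; ring
  map_smul' r x := by
    simp only [smul_comm _ r, map_smul, smul_eq_mul, RingHom.id_apply]; ring

lemma conjAverage_apply (φ : X →ₗ[ℝ] ℝ) (x : X) :
    conjAverage φ x = (φ x - φ (unitI • op unitI • x) - φ (unitJ • op unitJ • x)
      - φ (unitK • op unitK • x)) / 4 := rfl

lemma conjAverage_smul_comm [SMulCommClass ℍ ℍᵐᵒᵖ X] (φ : X →ₗ[ℝ] ℝ) (α : ℍ) (x : X) :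
    conjAverage φ (α • x) = conjAverage φ (op α • x) := by
  have comm : ∀ (a b : ℍ) (z : X), op a • b • z = b • op a • z := fun _ _ _ => (smul_comm _ _ _).symm
  have hi : conjAverage φ (unitI • x) = conjAverage φ (op unitI • x) := by
    simp only [conjAverage_apply, comm, smul_smul, ← op_mul]
    simp
    ring
  have hj : conjAverage φ (unitJ • x) = conjAverage φ (op unitJ • x) := by
    simp only [conjAverage_apply, comm, smul_smul, ← op_mul]
    simp
    ring
  have hk : conjAverage φ (unitK • x) = conjAverage φ (op unitK • x) := by
    simp only [conjAverage_apply, comm, smul_smul, ← op_mul]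
    simp
    ring
  rw [map_smul_eq, hi, hj, hk]
  conv_rhs => rw [eq_sum_units α]
  simp only [op_add, op_smul, op_one, add_smul, smul_assoc, one_smul, map_add, map_smul,
    smul_eq_mul]

end Bimodule

end QuaternionHahnBanach

open QuaternionHahnBanach

theorem stmt7 (X : Type*)
    [NormedAddCommGroup X] [NormedSpace ℝ X] [Module ℍ X] [Module ℍᵐᵒᵖ X]
    [IsScalarTower ℝ ℍ X] [IsScalarTower ℝ ℍᵐᵒᵖ X] [SMulCommClass ℍ ℍᵐᵒᵖ X]
    (hb : ∀ (α β : ℍ) (x : X), ‖α • op β • x‖ ≤ ‖α‖ * ‖x‖ * ‖β‖)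
    (Y : Submodule ℝ X)
    (hYl : ∀ (α : ℍ), ∀ y ∈ Y, α • y ∈ Y)
    (hYr : ∀ (α : ℍ), ∀ y ∈ Y, op α • y ∈ Y)
    (g : ↥Y →L[ℝ] ℍ)
    (hg : ∀ (α β : ℍ) (y : ↥Y),
      g ⟨α • op β • (y : X), hYl α _ (hYr β _ y.2)⟩ = α * g y * β) :
    ∃ G : X →L[ℝ] ℍ,
      (∀ (α β : ℍ) (x : X), G (α • op β • x) = α * G x * β) ∧
      (∀ y : ↥Y, G (y : X) = g y) ∧ ‖G‖ = ‖g‖ := by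
  have hl : ∀ (α : ℍ) (x : X), ‖α • x‖ ≤ ‖α‖ * ‖x‖ := fun α x => by
    simpa using hb α 1 x
  let reg : Y →L[ℝ] ℝ := LinearMap.mkContinuous
    { toFun := fun y => (g y).re
      map_add' := by simp
      map_smul' := by simp } ‖g‖ fun y => (re_le_norm _).trans (g.le_opNorm y)
  have hreg : ∀ y, reg y = (g y).re := fun _ => rfl
  obtain ⟨φ, hφ, hφn⟩ := exists_extension_norm_eq Y reg
  have hφg : ‖φ‖ ≤ ‖g‖ := hφn ▸ LinearMap.mkContinuous_norm_le _ (norm_nonneg g) _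
  let f : X →ₗ[ℝ] ℝ := conjAverage φ.toLinearMap
  have hfx : ∀ x, f x = (φ x - φ (unitI • op unitI • x) - φ (unitJ • op unitJ • x)
    - φ (unitK • op unitK • x)) / 4 := fun _ => rfl
  have hfb : ∀ x, |f x| ≤ ‖g‖ * ‖x‖ := by
    intro x
    have key : ∀ z : X, ‖z‖ ≤ ‖x‖ → |φ z| ≤ ‖g‖ * ‖x‖ := fun z hz =>
      (φ.le_opNorm z).trans (mul_le_mul hφg hz (norm_nonneg _) (ContinuousLinearMap.opNorm_nonneg g))
    have h0 := abs_le.1 (key x le_rfl)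
    have hi := abs_le.1 (key (unitI • op unitI • x) (by simpa [norm_unitI] using hb unitI unitI x))
    have hj := abs_le.1 (key (unitJ • op unitJ • x) (by simpa [norm_unitJ] using hb unitJ unitJ x))
    have hk := abs_le.1 (key (unitK • op unitK • x) (by simpa [norm_unitK] using hb unitK unitK x))
    rw [hfx, abs_le]
    constructor <;> linarith [h0.1, h0.2, hi.1, hi.2, hj.1, hj.2, hk.1, hk.2]
  have hφY : ∀ (α β : ℍ) (y : Y), φ (α • op β • (y : X)) = (α * g y * β).re := fun α β y => by
    rw [← hg, ← hreg, ← hφ]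
  have hfY : ∀ y : Y, f y = (g y).re := by
    intro y
    rw [hfx, hφ, hreg, hφY, hφY, hφY, re_mul_comm (unitI * _), re_mul_comm (unitJ * _),
      re_mul_comm (unitK * _)]
    simp only [← mul_assoc, unitI_mul_unitI, unitJ_mul_unitJ, unitK_mul_unitK, neg_mul, one_mul,
      Quaternion.re_neg]
    ring
  have hGb : ∀ x, ‖toQuaternion f x‖ ≤ ‖g‖ * ‖x‖ := fun x =>
    norm_toQuaternion_le f fun α => by
      calc |f (α • x)| ≤ ‖g‖ * ‖α • x‖ := hfb _
        _ ≤ ‖g‖ * (‖α‖ * ‖x‖) := by gcongr; exact hl α x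
        _ = ‖g‖ * ‖x‖ * ‖α‖ := by ring
  have hGY : ∀ y : Y, toQuaternion f y = g y := fun y => ext_re_mul fun γ => by
    have h := hg γ 1 y
    simp only [op_one, one_smul, mul_one] at h
    rw [re_mul_toQuaternion, ← h, ← hfY]
  refine ⟨(toQuaternion f).mkContinuous ‖g‖ hGb, toQuaternion_bimodule_map f
    (conjAverage_smul_comm _), hGY, le_antisymm
    (LinearMap.mkContinuous_norm_le _ (norm_nonneg g) _) ?_⟩
  refine g.opNorm_le_bound (ContinuousLinearMap.opNorm_nonneg _) fun y => ?_
  rw [← hGY y]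
  exact ((toQuaternion f).mkContinuous ‖g‖ hGb).le_opNorm y
end

section
/- Let X be a Hilbert right ℍ-module. Then there exists a unital ℝ-algebra homomorphism π from ℍ to the continuous ℝ-linear endomorphisms of X such that each π(α) is right ℍ-linear (π(α)(x·β) = (π(α)x)·β for all β ∈ ℍ) and ⟨π(α)x, y⟩ = ⟨x, π(star α)y⟩ for all α ∈ ℍ and x, y ∈ X. Equivalently, X carries a left ℍ-scalar multiplication making it a Hilbert ℍ-bimodule. -/
open MulOpposite

local notation "ℍ" => Quaternion ℝ

/-- A maximal orthonormal subset for a quaternionic inner product is total. -/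
theorem exists_total_orthonormal_quaternion {X : Type*}
    [AddCommGroup X] [Module ℍᵐᵒᵖ X] (inn : X → X → ℍ)
    (h_smul : ∀ (x y : X) (β : ℍ), inn x (op β • y) = inn x y * β)
    (h_star : ∀ x y : X, inn y x = star (inn x y))
    (h_pos : ∀ x : X, ∃ r : ℝ, 0 ≤ r ∧ inn x x = (r : ℍ))
    (h_def : ∀ x : X, inn x x = 0 → x = 0) :
    ∃ S : Set X, (∀ e ∈ S, inn e e = 1) ∧ (S.Pairwise fun e f => inn e f = 0) ∧
      ∀ x, (∀ e ∈ S, inn e x = 0) → x = 0 := by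
  obtain ⟨S, hS⟩ := zorn_subset
    {S : Set X | (∀ e ∈ S, inn e e = 1) ∧ S.Pairwise fun e f => inn e f = 0} (by
      intro c hc hchain
      refine ⟨⋃₀ c, ⟨?_, ?_⟩, fun s hs => Set.subset_sUnion_of_mem hs⟩
      · rintro e ⟨s, hs, he⟩
        exact (hc hs).1 e he
      · exact (Set.pairwise_sUnion hchain.directedOn).2 fun s hs => (hc hs).2)
  refine ⟨S, hS.prop.1, hS.prop.2, fun x hx => ?_⟩
  by_contra hx0
  obtain ⟨r, hr, hxr⟩ := h_pos x
  have hr0 : r ≠ 0 := by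
    rintro rfl
    exact hx0 (h_def x (by simpa using hxr))
  have hpos : 0 < r := lt_of_le_of_ne hr hr0.symm
  set u : X := op (((Real.sqrt r)⁻¹ : ℝ) : ℍ) • x with hu
  have hSu : ∀ e ∈ S, inn e u = 0 := fun e he => by rw [hu, h_smul, hx e he, zero_mul]
  have huu : inn u u = 1 := by
    have h1 : inn u x = (((Real.sqrt r)⁻¹ * r : ℝ) : ℍ) := by
      rw [h_star x u, hu, h_smul, hxr, star_mul]
      simp
    have h2 : (Real.sqrt r)⁻¹ * r * (Real.sqrt r)⁻¹ = 1 := by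
      have := Real.sqrt_pos.2 hpos
      field_simp
      exact (Real.sq_sqrt hr).symm
    nth_rewrite 2 [hu]
    rw [h_smul, h1, ← Quaternion.coe_mul, h2, Quaternion.coe_one]
  have hmem : u ∈ S := by
    refine hS.le_of_ge (y := insert u S) ⟨?_, ?_⟩ (Set.subset_insert u S) (Set.mem_insert u S)
    · rintro e (rfl | he)
      · exact huu
      · exact hS.prop.1 e he
    · refine hS.prop.2.insert fun e he _ => ⟨?_, hSu e he⟩
      rw [h_star e u, hSu e he, star_zero]
  exact one_ne_zero (huu.symm.trans (hSu u hmem))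

/-- Left multiplication by quaternions on `ℓ²(ι, ℍ)` is a `⋆`-action. -/
theorem lp_quaternion_inner_smul_left {ι : Type*} (α : ℍ) (f g : lp (fun _ : ι => ℍ) 2) :
    inner ℝ (α • f) g = inner ℝ f (star α • g) := by
  rw [lp.inner_eq_tsum, lp.inner_eq_tsum]
  refine tsum_congr fun i => ?_
  simp only [lp.coeFn_smul, Pi.smul_apply, smul_eq_mul, Quaternion.inner_def, star_mul, star_star]
  simp only [Quaternion.re_mul, Quaternion.imI_mul, Quaternion.imJ_mul, Quaternion.imK_mul,
    Quaternion.re_star, Quaternion.imI_star, Quaternion.imJ_star, Quaternion.imK_star]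
  ring

/-- A quaternion is determined by the real parts of its right multiples. -/
theorem Quaternion.eq_of_re_mul_eq {a b : ℍ} (h : ∀ q : ℍ, (a * q).re = (b * q).re) : a = b := by
  refine ext_inner_right ℝ fun v => ?_
  simpa [Quaternion.inner_def] using h (star v)

theorem stmt9 (X : Type*)
    [NormedAddCommGroup X] [NormedSpace ℝ X] [Module ℍᵐᵒᵖ X]
    [IsScalarTower ℝ ℍᵐᵒᵖ X] [CompleteSpace X]
    (inn : X → X → ℍ)
    (h_add_l : ∀ x y z : X, inn (x + y) z = inn x z + inn y z)
    (h_add_r : ∀ x y z : X, inn x (y + z) = inn x y + inn x z)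
    (h_smul : ∀ (x y : X) (β : ℍ), inn x (op β • y) = inn x y * β)
    (h_star : ∀ x y : X, inn y x = star (inn x y))
    (h_pos : ∀ x : X, ∃ r : ℝ, 0 ≤ r ∧ inn x x = (r : ℍ))
    (h_def : ∀ x : X, inn x x = 0 → x = 0)
    (h_norm : ∀ x : X, ‖x‖ = Real.sqrt ‖inn x x‖) :
    ∃ π : ℍ →ₐ[ℝ] (X →L[ℝ] X),
      (∀ (α β : ℍ) (x : X), π α (op β • x) = op β • (π α x)) ∧
      (∀ (α : ℍ) (x y : X), inn (π α x) y = inn x (π (star α) y)) := by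
  have h_smul_l : ∀ (x y : X) (β : ℍ), inn (op β • x) y = star β * inn x y := by
    intro x y β
    rw [h_star y, h_smul, star_mul, ← h_star]
  have h_real : ∀ (r : ℝ) (x : X), r • x = op (r : ℍ) • x := by
    intro r x
    have h : r • x = (r • (1 : ℍᵐᵒᵖ)) • x := by rw [smul_assoc, one_smul]
    rw [h]
    congr 1
    apply unop_injective
    simp [← Quaternion.coe_mul_eq_smul]
  have h_re : ∀ x y : X, (inn y x).re = (inn x y).re := by
    intro x y
    rw [h_star x y, Quaternion.re_star]
  have h_norm_sq : ∀ x : X, ‖x‖ ^ 2 = (inn x x).re := by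
    intro x
    obtain ⟨r, hr, hxr⟩ := h_pos x
    rw [h_norm, Real.sq_sqrt (norm_nonneg _), hxr, Quaternion.norm_coe, Real.norm_of_nonneg hr,
      Quaternion.re_coe]
  let _ : InnerProductSpace ℝ X :=
    { (inferInstance : NormedSpace ℝ X) with
      inner := fun x y => (inn x y).re
      norm_sq_eq_re_inner := h_norm_sq
      conj_inner_symm := h_re
      add_left := fun x y z => by rw [h_add_l, Quaternion.re_add]
      smul_left := fun x y r => by
        rw [h_real, h_smul_l]
        simp }
  have h_inner : ∀ x y : X, inner ℝ x y = (inn x y).re := fun _ _ => rfl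
  obtain ⟨S, hS1, hS0, hStot⟩ := exists_total_orthonormal_quaternion inn h_smul h_star h_pos h_def
  have hV_norm : ∀ (e : S) (q : ℍ), ‖op q • (e : X)‖ = ‖q‖ := by
    intro e q
    rw [h_norm, h_smul, h_smul_l, hS1 e e.2, mul_one, norm_mul, Quaternion.norm_star,
      Real.sqrt_mul_self (norm_nonneg _)]
  let V : S → ℍ →ₗᵢ[ℝ] X := fun e =>
    { toFun := fun q => op q • (e : X)
      map_add' := fun p q => by rw [op_add, add_smul]
      map_smul' := fun r q => by rw [op_smul, smul_assoc, RingHom.id_apply]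
      norm_map' := hV_norm e }
  have hV : ∀ e q, V e q = op q • (e : X) := fun _ _ => rfl
  have hV_orth : OrthogonalFamily ℝ (fun _ : S => ℍ) V := by
    intro e f hef p q
    rw [h_inner, hV, hV, h_smul, h_smul_l, hS0 e.2 f.2 (Subtype.coe_injective.ne hef), mul_zero, zero_mul]
    exact Quaternion.re_zero
  have hV_sum : IsHilbertSum ℝ (fun _ : S => ℍ) V := by
    refine IsHilbertSum.mk hV_orth ?_
    rw [top_le_iff, Submodule.topologicalClosure_eq_top_iff, Submodule.eq_bot_iff]
    intro x hx
    refine hStot x fun e he => ?_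
    rw [← star_eq_zero, ← h_star]
    refine Quaternion.eq_of_re_mul_eq fun q => ?_
    have h := (Submodule.mem_orthogonal' _ _).1 hx (V ⟨e, he⟩ q)
      (Submodule.mem_iSup_of_mem ⟨e, he⟩ ⟨q, rfl⟩)
    rw [h_inner, hV, h_smul] at h
    rw [h, zero_mul, Quaternion.re_zero]
  classical
  let U : X ≃ₗᵢ[ℝ] lp (fun _ : S => ℍ) 2 := hV_sum.linearIsometryEquiv
  have hU : ∀ (x : X) (e : S), U x e = inn e x := by
    intro x e
    refine ext_inner_left ℝ fun q => ?_
    rw [← lp.inner_single_left e q (U x), ← U.symm.inner_map_map, U.symm_apply_apply,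
      hV_sum.linearIsometryEquiv_symm_apply_single, h_inner, hV, h_smul_l, Quaternion.inner_def,
      ← Quaternion.re_star, star_mul, star_star]
    simp only [Quaternion.re_mul, Quaternion.re_star, Quaternion.imI_star, Quaternion.imJ_star,
      Quaternion.imK_star]
    ring
  let T : ℍ →ₐ[ℝ] (X →L[ℝ] X) := AlgHom.ofLinearMap
    { toFun := fun α => (U.symm : lp (fun _ : S => ℍ) 2 →L[ℝ] X) ∘L
        ContinuousLinearMap.lsmul ℝ ℍ α ∘L (U : X →L[ℝ] lp (fun _ : S => ℍ) 2)
      map_add' := fun α β => by ext x; simp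
      map_smul' := fun r α => by ext x; simp }
    (by ext x; simp) (fun α β => by ext x; simp [mul_smul])
  have hT : ∀ α x, U (T α x) = α • U x := fun α x => U.apply_symm_apply _
  have hT_right : ∀ (α β : ℍ) (x : X), T α (op β • x) = op β • T α x := by
    intro α β x
    apply U.injective
    ext1
    funext e
    rw [hT, hU, h_smul, ← hU, hT, lp.coeFn_smul, lp.coeFn_smul, Pi.smul_apply, Pi.smul_apply,
      hU, hU, h_smul, smul_eq_mul, smul_eq_mul, mul_assoc]
  refine ⟨T, hT_right, fun α x y => Quaternion.eq_of_re_mul_eq fun q => ?_⟩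
  rw [← h_smul, ← h_smul, ← hT_right, ← h_inner, ← h_inner, ← U.inner_map_map, hT,
    lp_quaternion_inner_smul_left, ← hT, U.inner_map_map]
end

section
/- Let Y be a Hilbert ℍ-bimodule. Then for all x, y in the real part Y_Re := {z ∈ Y : α • z = z • α for all α ∈ ℍ}, the inner product ⟨x, y⟩ is a real multiple of 1, i.e. ⟨x, y⟩ commutes with every quaternion (equivalently, α ⟨x,y⟩ = ⟨x,y⟩ α for all α ∈ ℍ). -/
open MulOpposite

local notation "ℍ" => Quaternion ℝ

/-- A quaternion commuting with every quaternion is real. -/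
theorem Quaternion.eq_coe_re_of_forall_commute {q : Quaternion ℝ}
    (h : ∀ α : Quaternion ℝ, α * q = q * α) : q = (q.re : Quaternion ℝ) := by
  have hJ (α : Quaternion ℝ) := congrArg QuaternionAlgebra.imJ (h α)
  have hK (α : Quaternion ℝ) := congrArg QuaternionAlgebra.imK (h α)
  simp only [Quaternion.imJ_mul, Quaternion.imK_mul] at hJ hK
  have hiJ := hJ ⟨0, 1, 0, 0⟩
  have hiK := hK ⟨0, 1, 0, 0⟩
  have hjK := hK ⟨0, 0, 1, 0⟩
  ext <;> simp <;> linarith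

theorem stmt11 (Y : Type*)
    [NormedAddCommGroup Y] [Module ℝ Y] [Module ℍ Y] [Module ℍᵐᵒᵖ Y]
    [IsScalarTower ℝ ℍ Y] [IsScalarTower ℝ ℍᵐᵒᵖ Y] [SMulCommClass ℍ ℍᵐᵒᵖ Y]
    [CompleteSpace Y]
    (inn : Y → Y → ℍ)
    (h_add_l : ∀ x y z : Y, inn (x + y) z = inn x z + inn y z)
    (h_add_r : ∀ x y z : Y, inn x (y + z) = inn x y + inn x z)
    (h_smul : ∀ (x y : Y) (β : ℍ), inn x (op β • y) = inn x y * β)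
    (h_star : ∀ x y : Y, inn y x = star (inn x y))
    (h_pos : ∀ x : Y, ∃ r : ℝ, 0 ≤ r ∧ inn x x = (r : ℍ))
    (h_def : ∀ x : Y, inn x x = 0 → x = 0)
    (h_norm : ∀ x : Y, ‖x‖ = Real.sqrt ‖inn x x‖)
    (h_compat : ∀ (α : ℍ) (x y : Y), inn (α • x) y = inn x ((star α) • y)) :
    ∀ x ∈ reSet Y, ∀ y ∈ reSet Y,
      (∃ r : ℝ, inn x y = (r : ℍ)) ∧ (∀ α : ℍ, α * inn x y = inn x y * α) := by
  intro x hx y hy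
  have hcomm : ∀ α : ℍ, α * inn x y = inn x y * α := by
    intro α
    have h : inn (star α • x) y = α * inn x y := by
      rw [hx, h_star y (op (star α) • x), h_smul, star_mul, star_star, ← h_star y x]
    rw [← h, h_compat, star_star, hy, h_smul]
  exact ⟨⟨_, Quaternion.eq_coe_re_of_forall_commute hcomm⟩, hcomm⟩
end

section
/- (Riesz representation theorem for quaternion Hilbert spaces) Let Y be a Hilbert ℍ-bimodule, let m : ℍ ⊗[ℝ] ℍ → ℍ be the ℝ-linear multiplication map (a ⊗ b ↦ ab), and let T : Y → ℍ ⊗[ℝ] ℍ be an ℝ-linear map satisfying T(α • x • β) = (1 ⊗ α) · T(x) · (1 ⊗ β) for all α, β ∈ ℍ, x ∈ Y (products taken in the ℝ-algebra ℍ ⊗[ℝ] ℍ), such that m ∘ T is bounded. Then there exists a unique y ∈ Y with m(T(x)) = ⟨y, x⟩ for all x ∈ Y, and moreover the operator norm of m ∘ T equals ‖y‖. -/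
open MulOpposite TensorProduct

local notation "ℍ" => Quaternion ℝ

theorem Quaternion.abs_re_le_norm (q : ℍ) : |q.re| ≤ ‖q‖ := by
  refine abs_le_of_sq_le_sq ?_ (norm_nonneg q)
  rw [sq ‖q‖, ← Quaternion.normSq_eq_norm_mul_self, Quaternion.normSq_def']
  nlinarith [sq_nonneg q.imI, sq_nonneg q.imJ, sq_nonneg q.imK]

/-- A quaternion `q` vanishes if all of its right multiples have zero real part. -/
theorem Quaternion.eq_zero_of_re_mul_eq_zero {q : ℍ} (h : ∀ β : ℍ, (q * β).re = 0) : q = 0 := by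
  have h' := h (star q)
  rw [Quaternion.self_mul_star, Quaternion.re_coe] at h'
  exact Quaternion.normSq_eq_zero.mp h'

theorem LinearMap.mul'_mul_one_tmul {R A : Type*} [CommSemiring R] [Semiring A] [Algebra R A]
    (t : A ⊗[R] A) (a : A) : LinearMap.mul' R A (t * (1 ⊗ₜ[R] a)) = LinearMap.mul' R A t * a := by
  induction t with
  | zero => simp
  | tmul b c => simp [mul_assoc]
  | add s t hs ht => rw [add_mul, map_add, map_add, hs, ht, add_mul]

theorem stmt15 (Y : Type*)
    [NormedAddCommGroup Y] [Module ℝ Y] [Module ℍ Y] [Module ℍᵐᵒᵖ Y]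
    [IsScalarTower ℝ ℍ Y] [IsScalarTower ℝ ℍᵐᵒᵖ Y] [SMulCommClass ℍ ℍᵐᵒᵖ Y]
    [CompleteSpace Y]
    (inn : Y → Y → ℍ)
    (h_add_l : ∀ x y z : Y, inn (x + y) z = inn x z + inn y z)
    (h_add_r : ∀ x y z : Y, inn x (y + z) = inn x y + inn x z)
    (h_smul : ∀ (x y : Y) (β : ℍ), inn x (op β • y) = inn x y * β)
    (h_star : ∀ x y : Y, inn y x = star (inn x y))
    (h_pos : ∀ x : Y, ∃ r : ℝ, 0 ≤ r ∧ inn x x = (r : ℍ))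
    (h_def : ∀ x : Y, inn x x = 0 → x = 0)
    (h_norm : ∀ x : Y, ‖x‖ = Real.sqrt ‖inn x x‖)
    (h_compat : ∀ (α : ℍ) (x y : Y), inn (α • x) y = inn x ((star α) • y))
    (T : Y →ₗ[ℝ] (ℍ ⊗[ℝ] ℍ))
    (hT : ∀ (α β : ℍ) (x : Y),
      T (α • op β • x) = (1 ⊗ₜ[ℝ] α) * T x * (1 ⊗ₜ[ℝ] β))
    (C : ℝ) (hC : ∀ x : Y, ‖LinearMap.mul' ℝ ℍ (T x)‖ ≤ C * ‖x‖) :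
    ∃ y : Y, (∀ x : Y, LinearMap.mul' ℝ ℍ (T x) = inn y x) ∧
      (∀ y' : Y, (∀ x : Y, LinearMap.mul' ℝ ℍ (T x) = inn y' x) → y' = y) ∧
      (∀ x : Y, ‖LinearMap.mul' ℝ ℍ (T x)‖ ≤ ‖y‖ * ‖x‖) ∧
      (∀ C' : ℝ, 0 ≤ C' → (∀ x : Y, ‖LinearMap.mul' ℝ ℍ (T x)‖ ≤ C' * ‖x‖) →
        ‖y‖ ≤ C') := by
  have op_coe_smul (r : ℝ) (x : Y) : op (r : ℍ) • x = r • x := by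
    have h : op (r : ℍ) = r • (1 : ℍᵐᵒᵖ) := by
      rw [← op_one, ← op_smul]
      rw [← Quaternion.coe_mul_eq_smul, mul_one]
    rw [h, smul_assoc, one_smul]
  have norm_sq (x : Y) : ‖x‖ ^ 2 = (inn x x).re := by
    obtain ⟨r, hr, hx⟩ := h_pos x
    rw [h_norm, Real.sq_sqrt (norm_nonneg _), hx, Quaternion.norm_coe, Real.norm_of_nonneg hr,
      Quaternion.re_coe]
  have inn_self (x : Y) : inn x x = ((‖x‖ ^ 2 : ℝ) : ℍ) := by
    obtain ⟨r, -, hx⟩ := h_pos x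
    rw [norm_sq, hx, Quaternion.re_coe]
  have norm_op_smul (β : ℍ) (x : Y) : ‖op β • x‖ = ‖β‖ * ‖x‖ := by
    have h : inn (op β • x) (op β • x) = star β * inn x x * β := by
      rw [h_smul, h_star x (op β • x), h_smul, star_mul, ← h_star]
    rw [h_norm, h, norm_mul, norm_mul, norm_star, h_norm x, mul_right_comm,
      Real.sqrt_mul (by positivity), Real.sqrt_mul_self (norm_nonneg _)]
  have inn_smul_right (r : ℝ) (x z : Y) : (inn x (r • z)).re = r * (inn x z).re := by
    rw [← op_coe_smul, h_smul, Quaternion.mul_coe_eq_smul, Quaternion.re_smul, smul_eq_mul]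
  have re_symm (x z : Y) : (inn z x).re = (inn x z).re := by
    rw [h_star, Quaternion.re_star]
  let _ : InnerProductSpace ℝ Y :=
    { toModule := inferInstance
      norm_smul_le := fun r x => by
        rw [← op_coe_smul, norm_op_smul, Quaternion.norm_coe]
      inner := fun x z => (inn x z).re
      norm_sq_eq_re_inner := norm_sq
      conj_inner_symm := fun x z => re_symm x z
      add_left := fun x y z => by
        rw [h_add_l, Quaternion.re_add]
      smul_left := fun x y r => by
        rw [re_symm, inn_smul_right, re_symm]
        rfl }
  set f : Y →ₗ[ℝ] ℍ := LinearMap.mul' ℝ ℍ ∘ₗ T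
  have f_apply (x : Y) : LinearMap.mul' ℝ ℍ (T x) = f x := rfl
  simp only [f_apply] at hC ⊢
  have f_smul (β : ℍ) (x : Y) : f (op β • x) = f x * β := by
    have h := hT 1 β x
    rw [one_smul] at h
    have h_one : (1 ⊗ₜ[ℝ] 1) * T x = T x := one_mul (M := ℍ ⊗[ℝ] ℍ) (T x)
    rw [h_one] at h
    rw [← f_apply, h]
    exact LinearMap.mul'_mul_one_tmul (T x) β
  let φ : Y →L[ℝ] ℝ := LinearMap.mkContinuous
    { toFun := fun x => (f x).re
      map_add' := fun x z => by simp
      map_smul' := fun r x => by simp } C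
    fun x => (Quaternion.abs_re_le_norm (f x)).trans (hC x)
  obtain ⟨y, hy⟩ : ∃ y : Y, ∀ x, (inn y x).re = (f x).re :=
    ⟨(InnerProductSpace.toDual ℝ Y).symm φ, fun x =>
      InnerProductSpace.toDual_symm_apply (x := x) (y := φ)⟩
  have f_eq (x : Y) : f x = inn y x := by
    refine sub_eq_zero.mp (Quaternion.eq_zero_of_re_mul_eq_zero fun β => ?_)
    rw [sub_mul, ← f_smul, ← h_smul, Quaternion.re_sub, hy, sub_self]
  refine ⟨y, f_eq, fun y' hy' => ?_, fun x => ?_, fun C' hC'₀ hC' => ?_⟩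
  · refine ext_inner_right ℝ fun x => ?_
    change (inn y' x).re = (inn y x).re
    rw [← hy', f_eq]
  · have h : ‖f x‖ * ‖f x‖ ≤ ‖f x‖ * (‖y‖ * ‖x‖) := by
      calc ‖f x‖ * ‖f x‖ = (inn y (op (star (f x)) • x)).re := by
            rw [hy, f_smul, Quaternion.self_mul_star, Quaternion.re_coe,
              Quaternion.normSq_eq_norm_mul_self]
        _ ≤ ‖y‖ * ‖op (star (f x)) • x‖ := real_inner_le_norm y _
        _ = ‖f x‖ * (‖y‖ * ‖x‖) := by rw [norm_op_smul, norm_star]; ring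
    rcases (norm_nonneg (f x)).eq_or_lt with h₀ | h₀
    · rw [← h₀]; positivity
    · exact le_of_mul_le_mul_left h h₀
  · have h := hC' y
    rw [f_eq, inn_self, Quaternion.norm_coe, Real.norm_of_nonneg (by positivity), sq] at h
    rcases (norm_nonneg y).eq_or_lt with h₀ | h₀
    · rwa [← h₀]
    · exact le_of_mul_le_mul_right h h₀
end

section
/- Let A be an ℍ-B*-algebra in which every element is normal, i.e. a* a = a a* for all a ∈ A. Then for all a, b in the real part A_Re one has a* b = b a*; moreover the involution is trivial on A_Re, i.e. a* = a for every a ∈ A_Re, and consequently A_Re is a commutative real algebra. -/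
open MulOpposite

local notation "ℍ" => Quaternion ℝ

lemma exists_quaternion_units : ∃ i j k : ℍ, i ≠ 0 ∧ k ≠ 0 ∧ star i = -i ∧ star j = -j ∧
    i * j = k ∧ j * i = -k := by
  have key : ∀ i j k : ℍ, i = ⟨0, 1, 0, 0⟩ → j = ⟨0, 0, 1, 0⟩ → k = ⟨0, 0, 0, 1⟩ →
      i ≠ 0 ∧ k ≠ 0 ∧ star i = -i ∧ star j = -j ∧ i * j = k ∧ j * i = -k := by
    intro i j k hi hj hk
    simp only [Quaternion.ext_iff, ne_eq, Quaternion.re_star, Quaternion.imI_star,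
      Quaternion.imJ_star, Quaternion.imK_star, Quaternion.re_neg, Quaternion.imI_neg,
      Quaternion.imJ_neg, Quaternion.imK_neg, Quaternion.re_mul, Quaternion.imI_mul,
      Quaternion.imJ_mul, Quaternion.imK_mul, Quaternion.re_zero, Quaternion.imI_zero,
      Quaternion.imJ_zero, Quaternion.imK_zero]
    simp [hi, hj, hk]
  exact ⟨_, _, _, key _ _ _ rfl rfl rfl⟩

theorem stmt19 (A : Type*) [NonUnitalNormedRing A] [StarRing A] [NormedSpace ℝ A]
    [IsScalarTower ℝ A A] [SMulCommClass ℝ A A] [StarModule ℝ A]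
    [CompleteSpace A] [CStarRing A]
    [Module ℍ A] [Module ℍᵐᵒᵖ A] [IsScalarTower ℝ ℍ A] [IsScalarTower ℝ ℍᵐᵒᵖ A]
    [SMulCommClass ℍ ℍᵐᵒᵖ A]
    (hnb : ∀ (α β : ℍ) (a : A), ‖α • op β • a‖ ≤ ‖α‖ * ‖a‖ * ‖β‖)
    (h1 : ∀ (γ : ℍ) (a b : A), (γ • a) * b = γ • (a * b))
    (h2 : ∀ (γ : ℍ) (a b : A), (op γ • a) * b = a * (γ • b))
    (h3 : ∀ (γ : ℍ) (a b : A), op γ • (a * b) = a * (op γ • b))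
    (h4 : ∀ (α : ℍ) (b : A), star (α • b) = op (star α) • (star b))
    (h5 : ∀ (α : ℍ) (b : A), star (op α • b) = (star α) • (star b))
    (hnormal : ∀ a : A, star a * a = a * star a) :
    (∀ a ∈ reSet A, ∀ b ∈ reSet A, star a * b = b * star a) ∧
    (∀ a ∈ reSet A, star a = a) ∧
    (∀ a ∈ reSet A, ∀ b ∈ reSet A, a * b = b * a) := by
  have hstar : ∀ x ∈ reSet A, star x ∈ reSet A := fun x hx α => by
    have h := congrArg star (hx (star α))
    rw [h4, h5, star_star] at h
    exact h.symm
  have hmul : ∀ x ∈ reSet A, ∀ y ∈ reSet A, x * y ∈ reSet A := fun x hx y hy α => by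
    rw [← h1, hx α, h2, hy α, h3]
  have hsmul : ∀ x ∈ reSet A, ∀ (α β : ℍ) (y : A),
      (α • x) * (β • y) = (α * β) • (x * y) := fun x hx α β y => by
    rw [h1, ← h2, ← hx β, h1, mul_smul]
  have hss : ∀ x ∈ reSet A, ∀ α : ℍ, star (α • x) = star α • star x := fun x hx α => by
    rw [h4, hstar x hx]
  have hpol : ∀ x ∈ reSet A, ∀ y ∈ reSet A, ∀ α β : ℍ,
      (star α * β) • (star x * y) + (star β * α) • (star y * x) =
        (α * star β) • (x * star y) + (β * star α) • (y * star x) := fun x hx y hy α β => by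
    have hx' := hnormal (α • x)
    have hy' := hnormal (β • y)
    have h := hnormal (α • x + β • y)
    rw [star_add, add_mul, mul_add, mul_add, add_mul, mul_add, mul_add, hx', hy'] at h
    rw [hss x hx, hss y hy] at h
    simp only [hsmul x hx, hsmul y hy, hsmul _ (hstar x hx), hsmul _ (hstar y hy)] at h
    rw [← sub_eq_zero] at h ⊢
    rw [← h]
    abel
  obtain ⟨i, j, k, hi, hk, hsi, hsj, hij, hji⟩ := exists_quaternion_units
  have e1 : ∀ x ∈ reSet A, ∀ y ∈ reSet A,
      star x * y + star y * x = x * star y + y * star x := fun x hx y hy => by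
    simpa using hpol x hx y hy 1 1
  have e2 : ∀ x ∈ reSet A, ∀ y ∈ reSet A,
      star x * y - star y * x = y * star x - x * star y := fun x hx y hy => by
    have h := hpol x hx y hy 1 i
    simp only [hsi, star_one, one_mul, mul_one, neg_smul] at h
    apply smul_right_injective A hi
    simp only [smul_sub]
    rw [sub_eq_add_neg, h]
    abel
  have e3 : ∀ x ∈ reSet A, ∀ y ∈ reSet A,
      star x * y - star y * x = x * star y - y * star x := fun x hx y hy => by
    have h := hpol x hx y hy i j
    simp only [hsi, hsj, hij, hji, neg_mul, mul_neg, neg_smul, neg_neg] at h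
    apply smul_right_injective A hk
    simp only [smul_sub]
    rw [← sub_eq_zero] at h ⊢
    rw [← neg_eq_zero, ← h]
    abel
  have hcomm : ∀ x ∈ reSet A, ∀ y ∈ reSet A, star x * y = y * star x := fun x hx y hy => by
    apply smul_right_injective A (two_ne_zero : (2 : ℝ) ≠ 0)
    simp only [two_smul]
    calc star x * y + star x * y
        = (star x * y + star y * x) + (star x * y - star y * x) := by abel
      _ = y * star x + y * star x := by rw [e1 x hx y hy, e2 x hx y hy]; abel
  have hswap : ∀ x ∈ reSet A, ∀ y ∈ reSet A, x * star y = star x * y := fun x hx y hy => by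
    apply smul_right_injective A (two_ne_zero : (2 : ℝ) ≠ 0)
    simp only [two_smul]
    have a1 := e2 x hx y hy
    rw [e3 x hx y hy] at a1
    rw [hcomm x hx y hy]
    rw [← sub_eq_zero] at a1 ⊢
    rw [← a1]
    abel
  have htriv : ∀ x ∈ reSet A, star x = x := fun x hx => by
    have hz : star x - x ∈ reSet A := fun α => by
      rw [smul_sub, smul_sub, hx α, hstar x hx α]
    have hzs : star (star x - x) = -(star x - x) := by rw [star_sub, star_star, neg_sub]
    rw [← sub_eq_zero]
    generalize star x - x = z at hz hzs
    have hs := hmul _ (hstar z hz) z hz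
    have hsa : star (star z * z) = star z * z := by rw [star_mul, star_star]
    have h := hswap _ hs z hz
    rw [hsa, hzs, mul_neg, ← hzs] at h
    have h0 : star z * z * z = 0 := by
      apply smul_right_injective A (two_ne_zero : (2 : ℝ) ≠ 0)
      simp only [two_smul, add_zero]
      nth_rewrite 1 [← h]
      exact neg_add_cancel _
    rw [← CStarRing.star_mul_self_eq_zero_iff, ← CStarRing.star_mul_self_eq_zero_iff, hsa]
    nth_rewrite 2 [hzs]
    rw [neg_mul, mul_neg, ← mul_assoc, h0, zero_mul, neg_zero]
  refine ⟨hcomm, htriv, fun x hx y hy => ?_⟩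
  simpa only [htriv x hx] using hcomm x hx y hy
end
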